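/- arXiv:0712.2389 — 3 statements merged into one kernel-verified Lean document; each statement's English description precedes it below -/
import Mathlib

section
/- Let I be a finite set with at least two elements, let a : I → ℤ with a(i) ≠ 0 for all i, let k ∈ ℤ, and let S = { f : I → ℤ | ∑_{i ∈ I} a(i)·f(i) = k } be the solution set of the linear equation. Assume S is nonempty. Then for every partition I = I₁ ⊎ I₂ into disjoint nonempty sets, there do not exist sets A ⊆ (I₁ → ℤ) and B ⊆ (I₂ → ℤ) with S = { f : I → ℤ | f|I₁ ∈ A and f|I₂ ∈ B }. (Linear equality constraints are never decomposable over unrestricted integer domains: every variable functionally depends on all others.) -/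
/-- Linear equality constraints are never decomposable (over unrestricted
integer domains): if `I` is finite with at least two elements, all coefficients
`a i` are nonzero, and the solution set
`S = {f | ∑ i, a i * f i = k}` is nonempty, then for every partition of `I`
into disjoint nonempty parts `I1 ⊎ I2` the set `S` is not a product
`{f | f|I1 ∈ A ∧ f|I2 ∈ B}`. -/
theorem stmt_11 {I : Type} [Fintype I] (hcard : 2 ≤ Fintype.card I)
    (a : I → ℤ) (ha : ∀ i, a i ≠ 0) (k : ℤ)
    (S : Set (I → ℤ)) (hS : S = {f : I → ℤ | ∑ i, a i * f i = k})
    (hne : S.Nonempty)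
    (I1 I2 : Set I) (hne1 : I1.Nonempty) (hne2 : I2.Nonempty)
    (hdisj : Disjoint I1 I2) (hcover : I1 ∪ I2 = Set.univ) :
    ¬ ∃ (A : Set (I1 → ℤ)) (B : Set (I2 → ℤ)),
        S = {f : I → ℤ |
              (fun i : I1 => f i) ∈ A ∧ (fun i : I2 => f i) ∈ B} := by
  classical
  rintro ⟨A, B, hAB⟩
  obtain ⟨f, hf⟩ := hne
  obtain ⟨p, hp⟩ := hne1
  obtain ⟨q, hq⟩ := hne2
  have hp2 : p ∉ I2 := fun h => Set.disjoint_left.mp hdisj hp h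
  have hq1 : q ∉ I1 := fun h => Set.disjoint_left.mp hdisj h hq
  have hfk : ∑ i, a i * f i = k := by rw [hS] at hf; exact hf
  have hsum : ∀ (r : I) (c : ℤ), ∑ i, a i * (Pi.single r c : I → ℤ) i = a r * c := by
    intro r c
    rw [Finset.sum_eq_single r]
    · simp
    · intro b _ hb
      simp [Pi.single_eq_of_ne hb]
    · simp
  have hg : (fun i => f i + (Pi.single p (a q) : I → ℤ) i
      + (Pi.single q (-a p) : I → ℤ) i) ∈ S := by
    rw [hS]
    simp only [Set.mem_setOf_eq, mul_add, Finset.sum_add_distrib, hsum, hfk]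
    ring
  have hh : (fun i => f i + (Pi.single p (a q) : I → ℤ) i) ∈ S := by
    rw [hAB] at hg hf ⊢
    refine ⟨?_, ?_⟩
    · convert hg.1 using 1
      funext i
      have : (i : I) ≠ q := fun h => hq1 (h ▸ i.2)
      simp [Pi.single_eq_of_ne this]
    · convert hf.2 using 1
      funext i
      have : (i : I) ≠ p := fun h => hp2 (h ▸ i.2)
      simp [Pi.single_eq_of_ne this]
  rw [hS] at hh
  simp only [Set.mem_setOf_eq, mul_add, Finset.sum_add_distrib, hsum, hfk] at hh
  exact mul_ne_zero (ha p) (ha q) (by linarith)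
end

section
/- Let X be a finite set of variables with finite domains D : X → Set V, and let l, u : V → ℕ be lower and upper cardinality bounds with l(v) = 0 for every value v ∉ ⋃_{x ∈ X} D(x). Let X = X₁ ⊎ X₂ be a partition into disjoint subsets such that U₁ = ⋃_{x ∈ X₁} D(x) and U₂ = ⋃_{x ∈ X₂} D(x) are disjoint. Then for every assignment s : X → V with s(x) ∈ D(x) for all x: s satisfies the global cardinality constraint on X (i.e., l(v) ≤ |{x ∈ X : s(x) = v}| ≤ u(v) for every v) if and only if for each j ∈ {1, 2} and every v ∈ U_j it holds that l(v) ≤ |{x ∈ X_j : s(x) = v}| ≤ u(v). Hence the global cardinality constraint decomposes, within the domains D, along any partition of the variables with disjoint domain value sets. -/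
/-- Decomposition of the global cardinality constraint: with lower bounds `l`
vanishing outside the union of the domains, if the variables are partitioned
as `X = X1 ⊎ X2` with disjoint unions of domain values `U1`, `U2`, then an
assignment `s` within the domains satisfies the global cardinality constraint
on `X` iff for each part `j` and every value `v ∈ U_j` the number of variables
`x ∈ X_j` with `s x = v` lies between `l v` and `u v`. -/
theorem stmt_13 {X V : Type} [Finite X] (D : X → Set V)
    (hDfin : ∀ x, (D x).Finite)
    (l u : V → ℕ) (hl : ∀ v : V, v ∉ (⋃ x, D x) → l v = 0)
    (X1 X2 : Set X) (hdisj : Disjoint X1 X2) (hcover : X1 ∪ X2 = Set.univ)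
    (hval : Disjoint (⋃ x ∈ X1, D x) (⋃ x ∈ X2, D x)) :
    ∀ s : X → V, (∀ x, s x ∈ D x) →
      ((∀ v : V, l v ≤ {x : X | s x = v}.ncard ∧ {x : X | s x = v}.ncard ≤ u v) ↔
        ((∀ v ∈ ⋃ x ∈ X1, D x,
            l v ≤ {x : X | x ∈ X1 ∧ s x = v}.ncard ∧
              {x : X | x ∈ X1 ∧ s x = v}.ncard ≤ u v) ∧
         (∀ v ∈ ⋃ x ∈ X2, D x,
            l v ≤ {x : X | x ∈ X2 ∧ s x = v}.ncard ∧
              {x : X | x ∈ X2 ∧ s x = v}.ncard ≤ u v))) := by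
  intro s hs
  have hc : ∀ x, x ∈ X1 ∨ x ∈ X2 := fun x => by
    have : x ∈ X1 ∪ X2 := hcover ▸ Set.mem_univ x
    exact this
  have m1 : ∀ x ∈ X1, s x ∈ ⋃ x ∈ X1, D x := fun x hx => Set.mem_biUnion hx (hs x)
  have m2 : ∀ x ∈ X2, s x ∈ ⋃ x ∈ X2, D x := fun x hx => Set.mem_biUnion hx (hs x)
  have hd := Set.disjoint_left.mp hval
  have e1 : ∀ v ∈ ⋃ x ∈ X1, D x, {x : X | x ∈ X1 ∧ s x = v} = {x : X | s x = v} := by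
    intro v hv
    ext x
    refine ⟨fun h => h.2, fun h => ⟨(hc x).resolve_right fun h2 => ?_, h⟩⟩
    have h' : s x = v := h
    exact hd hv (h' ▸ m2 x h2)
  have e2 : ∀ v ∈ ⋃ x ∈ X2, D x, {x : X | x ∈ X2 ∧ s x = v} = {x : X | s x = v} := by
    intro v hv
    ext x
    refine ⟨fun h => h.2, fun h => ⟨(hc x).resolve_left fun h1 => ?_, h⟩⟩
    have h' : s x = v := h
    exact hd (h' ▸ m1 x h1) hv
  constructor
  · intro h
    exact ⟨fun v hv => by rw [e1 v hv]; exact h v, fun v hv => by rw [e2 v hv]; exact h v⟩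
  · rintro ⟨h1, h2⟩ v
    by_cases hv : v ∈ ⋃ x, D x
    · obtain ⟨x, hx⟩ := Set.mem_iUnion.mp hv
      rcases hc x with hx1 | hx2
      · have hm : v ∈ ⋃ x ∈ X1, D x := Set.mem_biUnion hx1 hx
        have := h1 v hm
        rwa [e1 v hm] at this
      · have hm : v ∈ ⋃ x ∈ X2, D x := Set.mem_biUnion hx2 hx
        have := h2 v hm
        rwa [e2 v hm] at this
    · have he : {x : X | s x = v} = ∅ := by
        ext x
        simp only [Set.mem_setOf_eq, Set.mem_empty_iff_false, iff_false]
        intro h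
        exact hv (Set.mem_iUnion.mpr ⟨x, h ▸ hs x⟩)
      rw [he, hl v hv]
      simp
end

section
/- Let M be a deterministic finite automaton over alphabet α with state set σ, start state start, and accepting set accept (evalFrom q w denotes the state reached from state q after reading the word w, and M accepts w if evalFrom start w ∈ accept). Fix n ≥ 1, domains D : Fin n → Set α, an index d with 0 ≤ d ≤ n, and a state q. Let Acc = { w : Fin n → α | w(i) ∈ D(i) for all i, and M accepts the word w(0) w(1) ⋯ w(n−1) }. Assume that for every w ∈ Acc, evalFrom start (w(0) ⋯ w(d−1)) = q (i.e., layer d of the layered graph contains only the state q). Then Acc = { w : Fin n → α | w(i) ∈ D(i) for all i, evalFrom start (w(0) ⋯ w(d−1)) = q, and evalFrom q (w(d) ⋯ w(n−1)) ∈ accept }. In particular, within the domains, the Regular constraint decomposes into a constraint depending only on positions 0, …, d−1 and a constraint depending only on positions d, …, n−1. -/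
/-- Decomposition of the Regular constraint at a singleton layer of the
layered graph: let `Acc` be the set of words `w` (within the domains `D`)
accepted by the DFA `M`. If every `w ∈ Acc` reaches the state `q` after
reading its prefix of length `d` from the start state, then `Acc` consists
exactly of the words within the domains whose length-`d` prefix leads from
the start state to `q` and whose remaining suffix leads from `q` to an
accepting state; so the constraint splits at layer `d` into a prefix part and
a suffix part. -/
theorem stmt_15 {α σ : Type} (M : DFA α σ) (n : ℕ) (hn : 1 ≤ n)
    (D : Fin n → Set α) (d : ℕ) (hd : d ≤ n) (q : σ)
    (Acc : Set (Fin n → α))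
    (hAcc : Acc = {w : Fin n → α | (∀ i, w i ∈ D i) ∧
      M.evalFrom M.start (List.ofFn w) ∈ M.accept})
    (hlayer : ∀ w ∈ Acc,
      M.evalFrom M.start
        (List.ofFn (fun i : Fin d => w ⟨i, by have := i.isLt; omega⟩)) = q) :
    Acc = {w : Fin n → α | (∀ i, w i ∈ D i) ∧
      M.evalFrom M.start
        (List.ofFn (fun i : Fin d => w ⟨i, by have := i.isLt; omega⟩)) = q ∧
      M.evalFrom q
        (List.ofFn (fun i : Fin (n - d) =>
          w ⟨d + i, by have := i.isLt; omega⟩)) ∈ M.accept} := by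
  have key : ∀ w : Fin n → α, List.ofFn w =
      List.ofFn (fun i : Fin d => w ⟨i, by have := i.isLt; omega⟩) ++
      List.ofFn (fun i : Fin (n - d) => w ⟨d + i, by have := i.isLt; omega⟩) := by
    intro w
    apply List.ext_getElem
    · simp; omega
    · intro i h1 h2
      simp only [List.getElem_append, List.getElem_ofFn, List.length_ofFn]
      split_ifs with h
      · rfl
      · congr 2
        omega
  ext w
  constructor
  · intro hw
    have hq := hlayer w hw
    rw [hAcc] at hw
    obtain ⟨h1, h2⟩ := hw
    rw [key w, DFA.evalFrom_of_append, hq] at h2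
    exact ⟨h1, hq, h2⟩
  · rintro ⟨h1, hq, h2⟩
    rw [hAcc]
    refine ⟨h1, ?_⟩
    rw [key w, DFA.evalFrom_of_append, hq]
    exact h2
end
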